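/- Let G₁ = (V₁, ∅, L₁) and G₂ = (V₂, ∅, L₂) be directed graphs with no edges and labels in {0,1}^k such that for every label vector ℓ ∈ {0,1}^k the fraction of nodes carrying label ℓ is the same in both graphs, i.e. |{u ∈ V₁ : L₁(u) = ℓ}| / |V₁| = |{u ∈ V₂ : L₂(u) = ℓ}| / |V₂|. Then for every MPNN M ∈ M_mean with layers l₁,…,l_L, every layer index 0 ≤ i ≤ L, and all nodes u ∈ V₁, u' ∈ V₂ with L₁(u) = L₂(u'), the computed states coincide: x_u^{(i)} (computed on G₁) equals x_{u'}^{(i)} (computed on G₂). In particular M(G₁,u) = M(G₂,u'). -/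

import Mathlib

namespace PMLMPNN

/-- Modalities of Peano modal logic. -/
inductive Modality where
  | id | ein | eout | top
deriving DecidableEq

/-- A normalised integer inequality `∑ i, a i * ∏ (mon i) ≤ b`. -/
structure PeanoIneq (m : ℕ) where
  K : ℕ
  a : Fin K → ℤ
  mon : Fin K → List (Fin m)
  b : ℤ

/-- Value of a monomial (a list of variables) under an assignment. -/
def monValZ {m : ℕ} (c : Fin m → ℕ) (l : List (Fin m)) : ℤ :=
  (l.map (fun j => (c j : ℤ))).prod

def PeanoIneq.sat {m : ℕ} (t : PeanoIneq m) (c : Fin m → ℕ) : Bool :=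
  decide ((∑ i, t.a i * monValZ c (t.mon i)) ≤ t.b)

def PeanoIneq.deg {m : ℕ} (t : PeanoIneq m) : ℕ :=
  Finset.univ.sup (fun i => (t.mon i).length)

/-- Peano formulas: Boolean combinations of normalised inequalities. -/
inductive PeanoFormula (m : ℕ) where
  | ineq : PeanoIneq m → PeanoFormula m
  | not : PeanoFormula m → PeanoFormula m
  | and : PeanoFormula m → PeanoFormula m → PeanoFormula m

def PeanoFormula.sat {m : ℕ} (c : Fin m → ℕ) : PeanoFormula m → Bool
  | .ineq t => t.sat c
  | .not ψ => ! ψ.sat c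
  | .and ψ₁ ψ₂ => ψ₁.sat c && ψ₂.sat c

def PeanoFormula.deg {m : ℕ} : PeanoFormula m → ℕ
  | .ineq t => t.deg
  | .not ψ => ψ.deg
  | .and ψ₁ ψ₂ => max ψ₁.deg ψ₂.deg

/-- A term is homogeneous if it has no constant part and all its monomials
have the same degree. -/
def PeanoIneq.Homog {m : ℕ} (t : PeanoIneq m) : Prop :=
  t.b = 0 ∧ ∀ i, (t.mon i).length = t.deg

def PeanoFormula.Homog {m : ℕ} : PeanoFormula m → Prop
  | .ineq t => t.Homog
  | .not ψ => ψ.Homog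
  | .and ψ₁ ψ₂ => ψ₁.Homog ∧ ψ₂.Homog

/-- The set of monomials occurring in a Peano formula. -/
def PeanoFormula.mons {m : ℕ} : PeanoFormula m → Finset (List (Fin m))
  | .ineq t => Finset.univ.image t.mon
  | .not ψ => ψ.mons
  | .and ψ₁ ψ₂ => ψ₁.mons ∪ ψ₂.mons

/-- The set of constants occurring in a Peano formula. -/
def PeanoFormula.consts {m : ℕ} : PeanoFormula m → Finset ℤ
  | .ineq t => {t.b}
  | .not ψ => ψ.consts
  | .and ψ₁ ψ₂ => ψ₁.consts ∪ ψ₂.consts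

/-- PML formulas over `k` colours (propositions). -/
inductive PML (k : ℕ) where
  | prop : Fin k → PML k
  | not : PML k → PML k
  | and : PML k → PML k → PML k
  | modal : (m : ℕ) → (Fin m → Modality) → PeanoFormula m → (Fin m → PML k) → PML k

def PML.md {k : ℕ} : PML k → ℕ
  | .prop _ => 0
  | .not φ => φ.md
  | .and φ₁ φ₂ => max φ₁.md φ₂.md
  | .modal _ _ _ φs => 1 + Finset.univ.sup (fun i => (φs i).md)

def PML.deg {k : ℕ} : PML k → ℕ
  | .prop _ => 0
  | .not φ => φ.deg
  | .and φ₁ φ₂ => max φ₁.deg φ₂.deg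
  | .modal _ _ ψ φs => max ψ.deg (Finset.univ.sup (fun i => (φs i).deg))

def PML.onlyTop {k : ℕ} : PML k → Prop
  | .prop _ => True
  | .not φ => φ.onlyTop
  | .and φ₁ φ₂ => φ₁.onlyTop ∧ φ₂.onlyTop
  | .modal _ π _ φs => (∀ i, π i = Modality.top) ∧ (∀ i, (φs i).onlyTop)

def PML.onlyE {k : ℕ} : PML k → Prop
  | .prop _ => True
  | .not φ => φ.onlyE
  | .and φ₁ φ₂ => φ₁.onlyE ∧ φ₂.onlyE
  | .modal _ π _ φs => (∀ i, π i = Modality.ein ∨ π i = Modality.eout) ∧ (∀ i, (φs i).onlyE)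

/-- Propositional formulas: no modal subformula at all. -/
def PML.NoModal {k : ℕ} : PML k → Prop
  | .prop _ => True
  | .not φ => φ.NoModal
  | .and φ₁ φ₂ => φ₁.NoModal ∧ φ₂.NoModal
  | .modal _ _ _ _ => False

/-- Subformula relation. -/
inductive PML.Sub {k : ℕ} : PML k → PML k → Prop where
  | refl (φ : PML k) : PML.Sub φ φ
  | not {χ φ : PML k} : PML.Sub χ φ → PML.Sub χ (.not φ)
  | and_left {χ φ₁ φ₂ : PML k} : PML.Sub χ φ₁ → PML.Sub χ (.and φ₁ φ₂)
  | and_right {χ φ₁ φ₂ : PML k} : PML.Sub χ φ₂ → PML.Sub χ (.and φ₁ φ₂)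
  | modal {χ : PML k} {m : ℕ} {π : Fin m → Modality} {ψ : PeanoFormula m}
      {φs : Fin m → PML k} (i : Fin m) :
      PML.Sub χ (φs i) → PML.Sub χ (.modal m π ψ φs)

/-- Finite directed node-labelled graphs with `k` colours; labels in `{0,1}^k`
are represented by Boolean vectors. -/
structure Graph (k : ℕ) where
  n : ℕ
  E : Finset (Fin n × Fin n)
  L : Fin n → Fin k → Bool

def Graph.neighIn {k : ℕ} (G : Graph k) (v : Fin G.n) : Finset (Fin G.n) :=
  Finset.univ.filter (fun u => (u, v) ∈ G.E)

def Graph.neighOut {k : ℕ} (G : Graph k) (v : Fin G.n) : Finset (Fin G.n) :=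
  Finset.univ.filter (fun u => (v, u) ∈ G.E)

def Graph.Regular {k : ℕ} (G : Graph k) : Prop :=
  ∀ u v : Fin G.n,
    (G.neighIn u).card = (G.neighIn v).card ∧ (G.neighOut u).card = (G.neighOut v).card

/-- `v` is marked by colour `p`. -/
def Graph.MarkedBy {k : ℕ} (G : Graph k) (v : Fin G.n) (p : Fin k) : Prop :=
  ∀ u : Fin G.n, G.L u p = true ↔ u = v

/-- `v` is strongly marked by colour `p`: marked and `v ∈ neigh(v)`. -/
def Graph.StronglyMarkedBy {k : ℕ} (G : Graph k) (v : Fin G.n) (p : Fin k) : Prop :=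
  G.MarkedBy v p ∧ (v, v) ∈ G.E

def Graph.modSem {k : ℕ} (G : Graph k) (v : Fin G.n) : Modality → Finset (Fin G.n)
  | .id => {v}
  | .ein => G.neighIn v
  | .eout => G.neighOut v
  | .top => Finset.univ

/-- Satisfaction of PML formulas on pointed graphs. -/
def PML.sat {k : ℕ} (G : Graph k) : PML k → Fin G.n → Bool
  | .prop i, v => G.L v i
  | .not φ, v => ! PML.sat G φ v
  | .and φ₁ φ₂, v => PML.sat G φ₁ v && PML.sat G φ₂ v
  | .modal _ π ψ φs, v =>
      ψ.sat (fun i => ((G.modSem v (π i)).filter (fun u => PML.sat G (φs i) u = true)).card)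

/-- Feedforward neural networks with ReLU activations and rational weights. -/
inductive FNN : ℕ → ℕ → Type where
  | layer {din dout : ℕ} (w : Fin dout → Fin din → ℚ) (b : Fin dout → ℚ) : FNN din dout
  | comp {d₁ d₂ d₃ : ℕ} : FNN d₁ d₂ → FNN d₂ d₃ → FNN d₁ d₃

def FNN.eval : {din dout : ℕ} → FNN din dout → (Fin din → ℚ) → Fin dout → ℚ
  | _, _, .layer w b, x => fun j => max 0 (b j + ∑ i, w j i * x i)
  | _, _, .comp f g, x => g.eval (f.eval x)

/-- Aggregation functions on finite multisets of vectors. -/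
inductive Agg where
  | mean | sum | max
deriving DecidableEq

noncomputable def Agg.eval {d : ℕ} : Agg → Multiset (Fin d → ℚ) → Fin d → ℚ
  | .mean, s => fun i => (s.map (fun f => f i)).sum / (Multiset.card s : ℚ)
  | .sum, s => fun i => (s.map (fun f => f i)).sum
  | .max, s => fun i => ((s.map (fun f => f i)).toList).foldr Max.max 0

/-- One MPNN layer: a combination function (an FNN applied to the previous
state and the three aggregated messages) together with the choice of the two
local and the global aggregation functions. -/
structure MPNNLayer (din dout : ℕ) where
  comb : FNN (din + din + din + din) dout
  locIn : Agg
  locOut : Agg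
  glob : Agg

noncomputable def MPNNLayer.step {k din dout : ℕ} (l : MPNNLayer din dout) (G : Graph k)
    (x : Fin G.n → Fin din → ℚ) : Fin G.n → Fin dout → ℚ :=
  fun v => l.comb.eval
    (Fin.append (Fin.append (Fin.append (x v)
      (l.locIn.eval ((G.neighIn v).val.map x)))
      (l.locOut.eval ((G.neighOut v).val.map x)))
      (l.glob.eval ((Finset.univ : Finset (Fin G.n)).val.map x)))

/-- A message passing neural network: `L` layers with state dimensions
`dims 0, dims 1, …, dims L`. -/
structure MPNN where
  L : ℕ
  dims : ℕ → ℕ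
  layers : (i : ℕ) → MPNNLayer (dims i) (dims (i + 1))

/-- Initial state: the label of the node (padded with zeros if needed). -/
def Graph.init {k : ℕ} (G : Graph k) (d : ℕ) (v : Fin G.n) : Fin d → ℚ :=
  fun j => if h : (j : ℕ) < k then (if G.L v ⟨j, h⟩ then 1 else 0) else 0

/-- The state `x_v^{(i)}` computed by `M` on `G`. -/
noncomputable def MPNN.state {k : ℕ} (M : MPNN) (G : Graph k) : (i : ℕ) → Fin G.n → Fin (M.dims i) → ℚ
  | 0 => fun v => G.init (M.dims 0) v
  | i + 1 => (M.layers i).step G (M.state G i)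

/-- Last coordinate of a vector. -/
def lastVal {d : ℕ} (x : Fin d → ℚ) : ℚ :=
  if h : 0 < d then x ⟨d - 1, Nat.sub_lt h Nat.one_pos⟩ else 0

/-- The output `M(G,v)_⊥`: the last coordinate of the final state. -/
noncomputable def MPNN.out {k : ℕ} (M : MPNN) (G : Graph k) (v : Fin G.n) : ℚ :=
  lastVal (M.state G M.L v)

/-- All aggregations of `M` belong to the set `A`. -/
def MPNN.UsesAggs (M : MPNN) (A : Set Agg) : Prop :=
  ∀ i < M.L, (M.layers i).locIn ∈ A ∧ (M.layers i).locOut ∈ A ∧ (M.layers i).glob ∈ A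

/-- `M` belongs to the class `M_mean`. -/
def MPNN.IsMean (M : MPNN) : Prop := M.UsesAggs {Agg.mean}

/-- `M` recognises `φ` over the class `Cls` with certainty `c(|V|)`. -/
def Recognises {k : ℕ} (M : MPNN) (φ : PML k)
    (Cls : (G : Graph k) → Fin G.n → Prop) (c : ℕ → ℚ) : Prop :=
  ∀ (G : Graph k) (v : Fin G.n), Cls G v →
    (PML.sat G φ v = true → M.out G v = c G.n) ∧
    (PML.sat G φ v = false → M.out G v = 0)

end PMLMPNN
namespace PMLMPNN

/-- The mean of a label-determined state only depends on the label fractions. -/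
theorem mean_univ_eq {k d : ℕ} (G : Graph k) (f : (Fin k → Bool) → Fin d → ℚ) :
    Agg.mean.eval ((Finset.univ : Finset (Fin G.n)).val.map (fun u => f (G.L u))) =
    fun c => ∑ ℓ : Fin k → Bool,
      (((Finset.univ.filter (fun u : Fin G.n => G.L u = ℓ)).card : ℚ) / (G.n : ℚ)) * f ℓ c := by
  funext c
  have h : ∑ u : Fin G.n, f (G.L u) c = ∑ ℓ : Fin k → Bool,
      ((Finset.univ.filter (fun u : Fin G.n => G.L u = ℓ)).card : ℚ) * f ℓ c := by
    rw [← Finset.sum_fiberwise Finset.univ G.L]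
    refine Finset.sum_congr rfl fun ℓ _ => ?_
    rw [Finset.sum_congr rfl (g := fun _ => f ℓ c), Finset.sum_const, nsmul_eq_mul]
    intro u hu
    rw [(Finset.mem_filter.mp hu).2]
  have h' : Agg.mean.eval ((Finset.univ : Finset (Fin G.n)).val.map (fun u => f (G.L u))) c
      = (∑ u : Fin G.n, f (G.L u) c) / (G.n : ℚ) := by
    simp only [Agg.eval, Multiset.map_map, Multiset.card_map, Finset.card_val, Finset.card_univ,
      Fintype.card_fin]
    rfl
  rw [h', h, Finset.sum_div]
  exact Finset.sum_congr rfl fun ℓ _ => by ring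

theorem neighIn_empty {k : ℕ} (G : Graph k) (h : G.E = ∅) (v : Fin G.n) : G.neighIn v = ∅ := by
  simp [Graph.neighIn, h]

theorem neighOut_empty {k : ℕ} (G : Graph k) (h : G.E = ∅) (v : Fin G.n) : G.neighOut v = ∅ := by
  simp [Graph.neighOut, h]

/-- on edgeless graphs with identical label distributions,
mean MPNN compute identical states for equally labelled nodes, at every
layer. -/
theorem statement12 (k : ℕ) (G₁ G₂ : Graph k)
    (h₁ : G₁.E = ∅) (h₂ : G₂.E = ∅)
    (hfrac : ∀ ℓ : Fin k → Bool,
      ((Finset.univ.filter (fun u : Fin G₁.n => G₁.L u = ℓ)).card : ℚ) / (G₁.n : ℚ) =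
      ((Finset.univ.filter (fun u : Fin G₂.n => G₂.L u = ℓ)).card : ℚ) / (G₂.n : ℚ))
    (M : MPNN) (hM : M.IsMean) (hdin : M.dims 0 = k) :
    ∀ i ≤ M.L, ∀ (u : Fin G₁.n) (u' : Fin G₂.n), G₁.L u = G₂.L u' →
      M.state G₁ i u = M.state G₂ i u' := by
  have key : ∀ i ≤ M.L, ∃ f : (Fin k → Bool) → Fin (M.dims i) → ℚ,
      M.state G₁ i = (fun u => f (G₁.L u)) ∧ M.state G₂ i = (fun u => f (G₂.L u)) := by
    intro i
    induction i with
    | zero =>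
      intro _
      exact ⟨fun ℓ j => if h : (j : ℕ) < k then (if ℓ ⟨j, h⟩ then 1 else 0) else 0, rfl, rfl⟩
    | succ i ih =>
      intro hi
      obtain ⟨f, hf₁, hf₂⟩ := ih (by omega)
      have hg : (M.layers i).glob = Agg.mean := (hM i (by omega)).2.2
      refine ⟨fun ℓ => (M.layers i).comb.eval
        (Fin.append (Fin.append (Fin.append (f ℓ)
          ((M.layers i).locIn.eval 0)) ((M.layers i).locOut.eval 0))
          (fun c => ∑ ℓ' : Fin k → Bool,
            (((Finset.univ.filter (fun u : Fin G₁.n => G₁.L u = ℓ')).card : ℚ) / (G₁.n : ℚ))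
              * f ℓ' c)), ?_, ?_⟩
      · funext u
        simp only [MPNN.state, MPNNLayer.step, hf₁, neighIn_empty G₁ h₁, neighOut_empty G₁ h₁, hg,
          mean_univ_eq, Finset.empty_val, Multiset.map_zero]
      · funext u
        simp only [MPNN.state, MPNNLayer.step, hf₂, neighIn_empty G₂ h₂, neighOut_empty G₂ h₂, hg,
          mean_univ_eq, Finset.empty_val, Multiset.map_zero, hfrac]
  intro i hi u u' huu
  obtain ⟨f, hf₁, hf₂⟩ := key i hi
  rw [hf₁, hf₂]
  simp only [huu]

end PMLMPNN
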